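/- arXiv:2310.00988 — 2 statements merged into one kernel-verified Lean document; each statement's English description precedes it below -/
import Mathlib

section
/- Assume α = 1/2, 0 < β < 1 − γ, and 0 < γ < 1 (region F₁₂). Then there exist M > 0 and functions λ₁, λ₃ : ℝ → ℂ such that for every μ > M, λ₁(μ), its complex conjugate, λ₃(μ), and its complex conjugate are roots of f(·, μ), and as μ → ∞: Re λ₁(μ) = −(1/18)μ^(β+γ−1)(1+o(1)), Im λ₁(μ) = √3 · μ^((1−γ)/2)(1+o(1)), Re λ₃(μ) = −(1/2)(1+o(1)), and Im λ₃(μ) = (√6/3) · μ^(β/2)(1+o(1)). -/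
open Filter Real Topology

/-- Characteristic polynomial of the thermoelastic system with Cattaneo's law,
with inertial coefficient `m = 1`, wave speed `σ = 2`, relaxation `τ = 1`:
`f(λ, μ) = (μ^γ+1)λ⁴ + (μ^γ+1)λ³ + (μ^(2α)+μ^(β+γ)+2μ+μ^β)λ² + (μ^(2α)+2μ)λ + 2μ^(1+β)`. -/
noncomputable def charPoly (α β γ μ : ℝ) (l : ℂ) : ℂ :=
  ((μ ^ γ + 1 : ℝ) : ℂ) * l ^ 4 + ((μ ^ γ + 1 : ℝ) : ℂ) * l ^ 3 +
    ((μ ^ (2 * α) + μ ^ (β + γ) + 2 * μ + μ ^ β : ℝ) : ℂ) * l ^ 2 +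
    ((μ ^ (2 * α) + 2 * μ : ℝ) : ℂ) * l + ((2 * μ ^ (1 + β) : ℝ) : ℂ)

/-- With `q` near `C` and `s` near `2 * N / 3`, the quartic
`λ⁴ + λ³ + (C + N) λ² + C λ + (2 / 3) C N` factors over `ℝ` as
`(λ² + p λ + q) (λ² + (1 - p) λ + s)`; these are the coefficient conditions. -/
def IsFactorization (C N p q s : ℝ) : Prop :=
  C ≤ q ∧ q ≤ C + N ∧ 0 ≤ p ∧ p ≤ 1 ∧ q * s = 2 / 3 * C * N ∧
    p * (q - s) = q - C ∧ q + s + p * (1 - p) = C + N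

lemma exists_isFactorization {C N : ℝ} (hN : 0 < N) (hC : N < C) :
    ∃ p q s, IsFactorization C N p q s := by
  let s : ℝ → ℝ := fun q => 2 / 3 * C * N / q
  let p : ℝ → ℝ := fun q => (q - C) / (q - s q)
  let F : ℝ → ℝ := fun q => q + s q + p q * (1 - p q)
  have hC0 : 0 < C := hN.trans hC
  have hs0 : ∀ q, C ≤ q → 0 < s q := fun q hq => by
    have : 0 < q := hC0.trans_le hq
    positivity
  have hsC : ∀ q, C ≤ q → s q < C := fun q hq => by
    have : 0 < q := hC0.trans_le hq
    have : s q ≤ 2 / 3 * N := by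
      rw [div_le_iff₀ this]
      nlinarith [mul_le_mul_of_nonneg_left hq hN.le]
    linarith
  have hp0 : ∀ q, C ≤ q → 0 ≤ p q := fun q hq =>
    div_nonneg (by linarith) (by linarith [hsC q hq])
  have hp1 : ∀ q, C ≤ q → p q ≤ 1 := fun q hq =>
    div_le_one_of_le₀ (by linarith [hsC q hq]) (by linarith [hsC q hq])
  have hsc : ContinuousOn s (Set.Icc C (C + N)) :=
    continuousOn_const.div continuousOn_id fun q hq => (hC0.trans_le hq.1).ne'
  have hpc : ContinuousOn p (Set.Icc C (C + N)) :=
    (continuousOn_id.sub continuousOn_const).div (continuousOn_id.sub hsc) fun q hq =>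
      (sub_pos.2 ((hsC q hq.1).trans_le hq.1)).ne'
  have hFc : ContinuousOn F (Set.Icc C (C + N)) :=
    (continuousOn_id.add hsc).add (hpc.mul (continuousOn_const.sub hpc))
  have hlo : F C ≤ C + N := by
    have hs : s C = 2 / 3 * N := by simp only [s]; field_simp
    have hp : p C = 0 := by simp [p]
    simp only [F, hs, hp]
    linarith
  have hhi : C + N ≤ F (C + N) := by
    have hq : C ≤ C + N := by linarith
    have := mul_nonneg (hp0 _ hq) (sub_nonneg.2 (hp1 _ hq))
    have := hs0 _ hq
    simp only [F]
    linarith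
  obtain ⟨q, hq, hFq⟩ := intermediate_value_Icc (by linarith) hFc ⟨hlo, hhi⟩
  have hsq : q - s q ≠ 0 := (sub_pos.2 ((hsC q hq.1).trans_le hq.1)).ne'
  exact ⟨p q, q, s q, hq.1, hq.2, hp0 q hq.1, hp1 q hq.1,
    mul_div_cancel₀ _ (hC0.trans_le hq.1).ne', div_mul_cancel₀ _ hsq, hFq⟩

section Asymptotics

variable {ι : Type*} {l : Filter ι} {C N p q s : ι → ℝ}

lemma tendsto_of_isFactorization (hN : Tendsto N l atTop) (hC : Tendsto C l atTop)
    (hNC : Tendsto (fun x => N x / C x) l (𝓝 0))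
    (h : ∀ᶠ x in l, IsFactorization (C x) (N x) (p x) (q x) (s x)) :
    Tendsto (fun x => q x / C x) l (𝓝 1) ∧ Tendsto (fun x => s x / N x) l (𝓝 (2 / 3)) ∧
      Tendsto (fun x => p x * C x / N x) l (𝓝 (1 / 3)) ∧ Tendsto p l (𝓝 0) := by
  have hN0 : ∀ᶠ x in l, 0 < N x := hN.eventually_gt_atTop 0
  have hC0 : ∀ᶠ x in l, 0 < C x := hC.eventually_gt_atTop 0
  have hq : Tendsto (fun x => q x / C x) l (𝓝 1) := by
    have hup : Tendsto (fun x => 1 + N x / C x) l (𝓝 1) := by simpa using hNC.const_add 1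
    refine tendsto_of_tendsto_of_tendsto_of_le_of_le' tendsto_const_nhds hup ?_ ?_
    · filter_upwards [hC0, h] with x hc hx
      exact (one_le_div hc).2 hx.1
    · filter_upwards [hC0, h] with x hc hx
      have := div_le_div_of_nonneg_right hx.2.1 hc.le
      rwa [add_div, div_self hc.ne'] at this
  have hs : Tendsto (fun x => s x / N x) l (𝓝 (2 / 3)) := by
    have h1 : Tendsto (fun x => 2 / 3 / (q x / C x)) l (𝓝 (2 / 3)) := by
      simpa [Pi.div_def] using (tendsto_const_nhds (x := (2 / 3 : ℝ))).div hq one_ne_zero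
    refine h1.congr' ?_
    filter_upwards [hC0, hN0, h] with x hc hn hx
    obtain ⟨hCq, -, -, -, hqs, -, -⟩ := hx
    have : 0 < q x := hc.trans_le hCq
    field_simp
    linarith
  have hpp : Tendsto (fun x => p x * (1 - p x) / N x) l (𝓝 0) := by
    refine squeeze_zero' ?_ ?_ hN.inv_tendsto_atTop
    · filter_upwards [hN0, h] with x hn hx
      obtain ⟨-, -, hp0, hp1, -⟩ := hx
      exact div_nonneg (mul_nonneg hp0 (sub_nonneg.2 hp1)) hn.le
    · filter_upwards [hN0, h] with x hn hx
      obtain ⟨-, -, hp0, hp1, -⟩ := hx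
      rw [Pi.inv_apply, inv_eq_one_div]
      exact div_le_div_of_nonneg_right (by nlinarith) hn.le
  have hp : Tendsto (fun x => p x * C x / N x) l (𝓝 (1 / 3)) := by
    have h1 : Tendsto (fun x => (1 - s x / N x - p x * (1 - p x) / N x) /
        (q x / C x - s x / N x * (N x / C x))) l (𝓝 ((1 - 2 / 3 - 0) / (1 - 2 / 3 * 0))) :=
      ((hs.const_sub 1).sub hpp).div (hq.sub (hs.mul hNC)) (by norm_num)
    have h2 : ∀ᶠ x in l, 0 < q x / C x - s x / N x * (N x / C x) :=
      (hq.sub (hs.mul hNC)).eventually_const_lt (by norm_num)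
    norm_num at h1
    rw [one_div]
    simp only [inv_eq_one_div] at h1 ⊢
    refine h1.congr' ?_
    filter_upwards [hC0, hN0, h, h2] with x hc hn hx hd
    obtain ⟨-, -, -, -, -, hps, hsum⟩ := hx
    have e : q x / C x - s x / N x * (N x / C x) = (q x - s x) / C x := by
      field_simp
    rw [e] at hd ⊢
    have hd' : q x - s x ≠ 0 := by
      rintro h0
      simp [h0] at hd
    field_simp
    linarith
  refine ⟨hq, hs, hp, ?_⟩
  have h1 := hp.mul hNC
  rw [mul_zero] at h1
  refine h1.congr' ?_
  filter_upwards [hC0, hN0] with x hc hn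
  field_simp

end Asymptotics

lemma quadratic_root {p q y : ℝ} (h : y ^ 2 = q - p ^ 2 / 4) :
    (⟨-p / 2, y⟩ : ℂ) ^ 2 + p * ⟨-p / 2, y⟩ + q = 0 := by
  apply Complex.ext
  · simp [pow_two]
    nlinarith
  · simp [pow_two]
    ring

lemma charPoly_eq_mul {β γ μ p q s : ℝ} (hμ : 0 < μ)
    (h : IsFactorization (3 * μ / (μ ^ γ + 1)) (μ ^ β) p q s) (z : ℂ) :
    charPoly (1 / 2) β γ μ z =
      ((μ ^ γ + 1 : ℝ) : ℂ) * ((z ^ 2 + p * z + q) * (z ^ 2 + (1 - p : ℝ) * z + s)) := by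
  obtain ⟨-, -, -, -, hqs, hps, hsum⟩ := h
  have ha : 0 < μ ^ γ + 1 := by positivity
  have e2 : μ ^ (2 * (1 / 2) : ℝ) + μ ^ (β + γ) + 2 * μ + μ ^ β =
      (μ ^ γ + 1) * (q + s + p * (1 - p)) := by
    rw [hsum, rpow_add hμ]
    field_simp
    norm_num
    ring
  have e1 : μ ^ (2 * (1 / 2) : ℝ) + 2 * μ = (μ ^ γ + 1) * (p * s + q * (1 - p)) := by
    rw [show p * s + q * (1 - p) = 3 * μ / (μ ^ γ + 1) by linarith]
    field_simp
    norm_num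
    ring
  have e0 : 2 * μ ^ (1 + β) = (μ ^ γ + 1) * (q * s) := by
    rw [hqs, rpow_add hμ, rpow_one]
    field_simp
  rw [charPoly, e2, e1, e0]
  push_cast
  ring

lemma tendsto_sqrt_div {ι : Type*} {l : Filter ι} {f g h : ι → ℝ} (hh : ∀ᶠ x in l, 0 ≤ h x)
    (hg : ∀ᶠ x in l, g x = √(h x)) (H : Tendsto (fun x => f x / h x) l (𝓝 1)) :
    Tendsto (fun x => √(f x) / g x) l (𝓝 1) := by
  have := H.sqrt
  rw [sqrt_one] at this
  refine this.congr' ?_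
  filter_upwards [hh, hg] with x hx hgx
  rw [hgx, sqrt_div' _ hx]

theorem charPoly_roots_F12 (α β γ : ℝ)
    (h1 : α = 1 / 2) (h2 : 0 < β) (h3 : β < 1 - γ)
    (h4 : 0 < γ) (h5 : γ < 1) :
    ∃ M > (0 : ℝ), ∃ l1 l3 : ℝ → ℂ,
      (∀ μ > M,
        charPoly α β γ μ (l1 μ) = 0 ∧ charPoly α β γ μ ((starRingEnd ℂ) (l1 μ)) = 0 ∧
        charPoly α β γ μ (l3 μ) = 0 ∧ charPoly α β γ μ ((starRingEnd ℂ) (l3 μ)) = 0) ∧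
      Tendsto (fun μ : ℝ => (l1 μ).re / (-(1 / 18) * μ ^ (β + γ - 1))) atTop (𝓝 1) ∧
      Tendsto (fun μ : ℝ => (l1 μ).im / (Real.sqrt 3 * μ ^ ((1 - γ) / 2))) atTop (𝓝 1) ∧
      Tendsto (fun μ : ℝ => (l3 μ).re / (-(1 / 2) : ℝ)) atTop (𝓝 1) ∧
      Tendsto (fun μ : ℝ => (l3 μ).im / (Real.sqrt 6 / 3 * μ ^ (β / 2))) atTop (𝓝 1) := by
  subst h1
  set N : ℝ → ℝ := fun μ => μ ^ β
  set C : ℝ → ℝ := fun μ => 3 * μ / (μ ^ γ + 1)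
  have hN : Tendsto N atTop atTop := tendsto_rpow_atTop h2
  have hK : Tendsto (fun μ : ℝ => μ ^ (1 - γ)) atTop atTop := tendsto_rpow_atTop (by linarith)
  have hCK : Tendsto (fun μ => C μ / μ ^ (1 - γ)) atTop (𝓝 3) := by
    have h : Tendsto (fun μ : ℝ => 3 / (1 + (μ ^ γ)⁻¹)) atTop (𝓝 (3 / (1 + 0))) :=
      tendsto_const_nhds.div ((tendsto_rpow_atTop h4).inv_tendsto_atTop.const_add 1) (by norm_num)
    norm_num at h
    refine h.congr' ?_
    filter_upwards [eventually_gt_atTop 0] with μ hμ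
    simp only [C]
    rw [rpow_sub hμ, rpow_one]
    have := rpow_pos_of_pos hμ γ
    field_simp
  have hC : Tendsto C atTop atTop := by
    refine (hCK.pos_mul_atTop (by norm_num) hK).congr' ?_
    filter_upwards [eventually_gt_atTop 0] with μ hμ
    exact div_mul_cancel₀ _ (rpow_pos_of_pos hμ _).ne'
  have hNC : Tendsto (fun μ => N μ / C μ) atTop (𝓝 0) := by
    have h : Tendsto (fun μ : ℝ => μ ^ (-(1 - γ - β)) / (C μ / μ ^ (1 - γ))) atTop (𝓝 (0 / 3)) :=
      (tendsto_rpow_neg_atTop (by linarith)).div hCK (by norm_num)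
    rw [zero_div] at h
    refine h.congr' ?_
    filter_upwards [eventually_gt_atTop 0] with μ hμ
    rw [show -(1 - γ - β) = β - (1 - γ) by ring, rpow_sub hμ]
    have := rpow_pos_of_pos hμ (1 - γ)
    have : 0 < C μ := by positivity
    simp only [N]
    field_simp
  have hex : ∀ᶠ μ in atTop, ∃ p q s, IsFactorization (C μ) (N μ) p q s := by
    filter_upwards [hN.eventually_gt_atTop 0, hC.eventually_gt_atTop 0,
      hNC.eventually_lt_const one_pos] with μ hn hc hnc
    exact exists_isFactorization hn ((div_lt_one hc).1 hnc)
  have hex' : ∀ μ, ∃ p q s, (∃ p q s, IsFactorization (C μ) (N μ) p q s) →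
      IsFactorization (C μ) (N μ) p q s := fun μ => by
    by_cases h : ∃ p q s, IsFactorization (C μ) (N μ) p q s
    · obtain ⟨p, q, s, h⟩ := h
      exact ⟨p, q, s, fun _ => h⟩
    · exact ⟨0, 0, 0, fun h' => absurd h' h⟩
  choose p q s hpqs using hex'
  have hfac : ∀ᶠ μ in atTop, IsFactorization (C μ) (N μ) (p μ) (q μ) (s μ) :=
    hex.mono fun μ => hpqs μ
  obtain ⟨hq, hs, hpC, hp⟩ := tendsto_of_isFactorization hN hC hNC hfac
  have hp4 : Tendsto (fun μ => p μ ^ 2 / 4) atTop (𝓝 0) := by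
    simpa using (hp.pow 2).div_const 4
  have hr4 : Tendsto (fun μ => (1 - p μ) ^ 2 / 4) atTop (𝓝 (1 / 4)) := by
    simpa using ((hp.const_sub 1).pow 2).div_const 4
  have hQ : Tendsto (fun μ => (q μ - p μ ^ 2 / 4) / (3 * μ ^ (1 - γ))) atTop (𝓝 1) := by
    have h := ((hq.mul hCK).sub (hp4.div_atTop hK)).div_const 3
    norm_num at h
    refine h.congr' ?_
    filter_upwards [eventually_gt_atTop 0] with μ hμ
    have := rpow_pos_of_pos hμ (1 - γ)
    have : 0 < C μ := by positivity
    field_simp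
  have hS : Tendsto (fun μ => (s μ - (1 - p μ) ^ 2 / 4) / (2 / 3 * μ ^ β)) atTop (𝓝 1) := by
    have h := (hs.sub (hr4.div_atTop hN)).div_const (2 / 3)
    norm_num at h
    refine h.congr' ?_
    filter_upwards [eventually_gt_atTop 0] with μ hμ
    have := rpow_pos_of_pos hμ β
    simp only [N]
    field_simp
  have hgood : ∀ᶠ μ in atTop, 0 < μ ∧ IsFactorization (C μ) (N μ) (p μ) (q μ) (s μ) ∧
      0 ≤ q μ - p μ ^ 2 / 4 ∧ 0 ≤ s μ - (1 - p μ) ^ 2 / 4 := by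
    filter_upwards [eventually_gt_atTop 0, hfac, hQ.eventually_const_lt one_pos,
      hS.eventually_const_lt one_pos] with μ hμ hf hq hs
    have h₁ : 0 < 3 * μ ^ (1 - γ) := by positivity
    have h₂ : 0 < 2 / 3 * μ ^ β := by positivity
    exact ⟨hμ, hf, ((div_pos_iff_of_pos_right h₁).1 hq).le,
      ((div_pos_iff_of_pos_right h₂).1 hs).le⟩
  obtain ⟨M, hM⟩ := eventually_atTop.1 hgood
  refine ⟨max M 1, by positivity, fun μ => ⟨-p μ / 2, √(q μ - p μ ^ 2 / 4)⟩,
    fun μ => ⟨-(1 - p μ) / 2, √(s μ - (1 - p μ) ^ 2 / 4)⟩, ?_, ?_, ?_, ?_, ?_⟩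
  · intro μ hμ
    obtain ⟨hμ0, hf, hq0, hs0⟩ := hM μ ((le_max_left _ _).trans hμ.le)
    refine ⟨?_, ?_, ?_, ?_⟩ <;> rw [charPoly_eq_mul hμ0 hf]
    · rw [quadratic_root (sq_sqrt hq0)]
      simp
    · rw [show (starRingEnd ℂ) ⟨-p μ / 2, √(q μ - p μ ^ 2 / 4)⟩ =
        ⟨-p μ / 2, -√(q μ - p μ ^ 2 / 4)⟩ from rfl, quadratic_root (by rw [neg_sq, sq_sqrt hq0])]
      simp
    · rw [quadratic_root (sq_sqrt hs0)]
      simp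
    · rw [show (starRingEnd ℂ) ⟨-(1 - p μ) / 2, √(s μ - (1 - p μ) ^ 2 / 4)⟩ =
        ⟨-(1 - p μ) / 2, -√(s μ - (1 - p μ) ^ 2 / 4)⟩ from rfl,
        quadratic_root (by rw [neg_sq, sq_sqrt hs0])]
      simp
  · have h := (hpC.div hCK (by norm_num)).const_mul 9
    norm_num at h
    refine h.congr' ?_
    filter_upwards [eventually_gt_atTop 0] with μ hμ
    rw [show β + γ - 1 = β - (1 - γ) by ring, rpow_sub hμ β]
    have := rpow_pos_of_pos hμ (1 - γ)
    have := rpow_pos_of_pos hμ β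
    have : 0 < C μ := by positivity
    simp only [N]
    field_simp
    ring
  · refine tendsto_sqrt_div ?_ ?_ hQ
    · filter_upwards [eventually_gt_atTop 0] with μ hμ
      positivity
    · filter_upwards [eventually_gt_atTop 0] with μ hμ
      rw [sqrt_mul (by norm_num), sqrt_eq_rpow (μ ^ (1 - γ)), ← rpow_mul hμ.le]
      ring_nf
  · have h := hp.const_sub 1
    rw [sub_zero] at h
    refine h.congr fun μ => ?_
    ring
  · refine tendsto_sqrt_div ?_ ?_ hS
    · filter_upwards [eventually_gt_atTop 0] with μ hμ
      positivity
    · filter_upwards [eventually_gt_atTop 0] with μ hμ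
      have h6 : √6 / 3 = √(2 / 3) := by
        rw [eq_comm, sqrt_eq_iff_mul_self_eq (by norm_num) (by positivity)]
        nlinarith [sq_sqrt (show (0 : ℝ) ≤ 6 by norm_num)]
      rw [h6, sqrt_mul (by norm_num), sqrt_eq_rpow (μ ^ β), ← rpow_mul hμ.le]
      ring_nf
end

section
/- Assume 0 ≤ α < 1/2, β = 1 − γ, and 0 < γ < 1 (region F₂₃). Then there exist M > 0 and functions λ₁, λ₃ : ℝ → ℂ such that for every μ > M, λ₁(μ), its complex conjugate, λ₃(μ), and its complex conjugate are roots of f(·, μ), and as μ → ∞: Re λ₁(μ) = −(1/2)μ^(2α−1)(1+o(1)), Im λ₁(μ) = √2 · μ^((1−γ)/2)(1+o(1)), Re λ₃(μ) = −(1/2)(1+o(1)), and Im λ₃(μ) = μ^((1−γ)/2)(1+o(1)). -/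
open Filter Real Topology

/-- The characteristic polynomial in the rescaled variables `ε = 1 / √b`, `η = b / μ`,
`κ = μ ^ (2α) / μ`, where `b = μ ^ (1 - γ)` and `l = √b z`; see `charPoly_rescale`. -/
def rescaledQuartic (ε η κ : ℝ) (z : ℂ) : ℂ :=
  (z ^ 2 + ε * z + 1) * ((1 + η) * z ^ 2 + 2 + κ) - κ

theorem Polynomial.exists_isRoot_norm_sub_pow_le {p : Polynomial ℂ} (hp : p.natDegree ≠ 0)
    (w : ℂ) :
    ∃ r, p.IsRoot r ∧ ‖p.leadingCoeff‖ * ‖w - r‖ ^ p.natDegree ≤ ‖p.eval w‖ := by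
  have hsplit : p.Splits := IsAlgClosed.splits p
  have hcard : p.roots.card = p.natDegree := hsplit.natDegree_eq_card_roots.symm
  have hp0 : p ≠ 0 := by rintro rfl; simp at hp
  have hne : p.roots.toFinset.Nonempty := by
    rw [Multiset.toFinset_nonempty]
    intro h
    rw [h] at hcard
    exact hp hcard.symm
  obtain ⟨r, hr, hmin⟩ := p.roots.toFinset.exists_min_image (fun r => ‖w - r‖) hne
  simp only [Multiset.mem_toFinset] at hr hmin
  have hprod : ∀ s : Multiset ℂ, (∀ t ∈ s, ‖w - r‖ ≤ ‖w - t‖) →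
      ‖w - r‖ ^ s.card ≤ ‖(s.map (w - ·)).prod‖ := by
    intro s
    induction s using Multiset.induction_on with
    | empty => simp
    | cons a s ih =>
      intro h
      rw [Multiset.card_cons, Multiset.map_cons, Multiset.prod_cons, norm_mul, pow_succ']
      exact mul_le_mul (h a (Multiset.mem_cons_self a s))
        (ih fun t ht => h t (Multiset.mem_cons_of_mem ht)) (by positivity) (norm_nonneg _)
  refine ⟨r, (Polynomial.mem_roots hp0).1 hr, ?_⟩
  rw [hsplit.eval_eq_prod_roots w, norm_mul, ← hcard]
  exact mul_le_mul_of_nonneg_left (hprod _ hmin) (norm_nonneg _)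

theorem exists_rescaledQuartic_root_near {η : ℝ} (hη : 0 ≤ η) (ε κ : ℝ) (w : ℂ) :
    ∃ z, rescaledQuartic ε η κ z = 0 ∧ ‖z - w‖ ^ 4 ≤ ‖rescaledQuartic ε η κ w‖ := by
  let p : Polynomial ℂ :=
    (.X ^ 2 + .C (ε : ℂ) * .X + 1) * (.C ((1 : ℂ) + η) * .X ^ 2 + .C ((2 : ℂ) + κ)) - .C (κ : ℂ)
  have heval : ∀ z, p.eval z = rescaledQuartic ε η κ z := by
    intro z
    simp only [p, rescaledQuartic, Polynomial.eval_sub, Polynomial.eval_mul, Polynomial.eval_add,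
      Polynomial.eval_pow, Polynomial.eval_X, Polynomial.eval_C, Polynomial.eval_one]
    ring
  have hlead : ((1 : ℂ) + η) ≠ 0 := by
    rw [← Complex.ofReal_one, ← Complex.ofReal_add]
    exact Complex.ofReal_ne_zero.2 (by positivity)
  have h2 : (.X ^ 2 + .C (ε : ℂ) * .X + 1 : Polynomial ℂ).natDegree = 2 := by compute_degree!
  have h3 : (.C ((1 : ℂ) + η) * .X ^ 2 + .C ((2 : ℂ) + κ) : Polynomial ℂ).natDegree = 2 := by
    rw [Polynomial.natDegree_add_C, Polynomial.natDegree_C_mul_X_pow 2 _ hlead]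
  have hcoeff4 : p.coeff 4 = 1 + η := by
    have h := Polynomial.coeff_mul_degree_add_degree
      (.X ^ 2 + .C (ε : ℂ) * .X + 1 : Polynomial ℂ) (.C ((1 : ℂ) + η) * .X ^ 2 + .C ((2 : ℂ) + κ))
    rw [Polynomial.leadingCoeff, Polynomial.leadingCoeff, h2, h3] at h
    simp only [p, Polynomial.coeff_sub, h]
    simp [Polynomial.coeff_one, -map_add]
  have hdeg : p.natDegree = 4 := by
    refine le_antisymm ?_ (Polynomial.le_natDegree_of_ne_zero (by rwa [hcoeff4]))
    rw [Polynomial.natDegree_sub_C]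
    exact Polynomial.natDegree_mul_le.trans (by rw [h2, h3])
  have hcoeff : p.leadingCoeff = 1 + η := by rw [Polynomial.leadingCoeff, hdeg, hcoeff4]
  obtain ⟨z, hz, hle⟩ :=
    Polynomial.exists_isRoot_norm_sub_pow_le (p := p) (by rw [hdeg]; norm_num) w
  refine ⟨z, (heval z).symm.trans hz, ?_⟩
  have hnorm : 1 ≤ ‖p.leadingCoeff‖ := by
    rw [hcoeff, ← Complex.ofReal_one, ← Complex.ofReal_add, Complex.norm_real,
      Real.norm_of_nonneg (by positivity)]
    linarith
  rw [hdeg, heval] at hle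
  rw [norm_sub_rev]
  exact (le_mul_of_one_le_left (by positivity) hnorm).trans hle

theorem exists_tendsto_rescaledQuartic_root {ι : Type*} {l : Filter ι} {ε η κ : ι → ℝ}
    (hη : ∀ᶠ i in l, 0 ≤ η i) (hε0 : Tendsto ε l (𝓝 0)) (hη0 : Tendsto η l (𝓝 0))
    (hκ0 : Tendsto κ l (𝓝 0)) {w : ℂ} (hw : (w ^ 2 + 1) * (w ^ 2 + 2) = 0) :
    ∃ z : ι → ℂ, (∀ i, 0 ≤ η i → rescaledQuartic (ε i) (η i) (κ i) (z i) = 0) ∧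
      Tendsto z l (𝓝 w) := by
  have hex : ∀ i, ∃ z, 0 ≤ η i → rescaledQuartic (ε i) (η i) (κ i) z = 0 ∧
      ‖z - w‖ ^ 4 ≤ ‖rescaledQuartic (ε i) (η i) (κ i) w‖ := fun i => by
    by_cases hi : 0 ≤ η i
    · exact (exists_rescaledQuartic_root_near hi (ε i) (κ i) w).imp fun _ hz _ => hz
    · exact ⟨0, fun h => absurd h hi⟩
  choose z hz using hex
  refine ⟨z, fun i hi => (hz i hi).1, ?_⟩
  have hlim : Tendsto (fun i => rescaledQuartic (ε i) (η i) (κ i) w) l (𝓝 0) := by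
    have hcont : Continuous fun t : ℝ × ℝ × ℝ => rescaledQuartic t.1 t.2.1 t.2.2 w := by
      unfold rescaledQuartic
      fun_prop
    have h := (hcont.tendsto (0, 0, 0)).comp (hε0.prodMk_nhds (hη0.prodMk_nhds hκ0))
    have hval : rescaledQuartic 0 0 0 w = 0 := by
      simp only [rescaledQuartic, Complex.ofReal_zero]
      linear_combination hw
    simp only [hval] at h
    exact h
  have hpow : Tendsto (fun i => ‖z i - w‖ ^ 4) l (𝓝 0) :=
    squeeze_zero' (.of_forall fun i => by positivity) (hη.mono fun i hi => (hz i hi).2)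
      (by simpa using hlim.norm)
  rw [tendsto_iff_norm_sub_tendsto_zero]
  rw [Metric.tendsto_nhds] at hpow ⊢
  intro e he
  filter_upwards [hpow (e ^ 4) (by positivity)] with i hi
  simp only [dist_zero_right, norm_pow, norm_norm] at hi ⊢
  exact lt_of_pow_lt_pow_left₀ 4 he.le hi

theorem charPoly_conj (α β γ μ : ℝ) (l : ℂ) :
    charPoly α β γ μ (starRingEnd ℂ l) = starRingEnd ℂ (charPoly α β γ μ l) := by
  simp only [charPoly, map_add, map_mul, map_pow, Complex.conj_ofReal]

theorem charPoly_rescale {α γ μ s : ℝ} (hμ : 0 < μ) (hs : 0 < s) (hsμ : s ^ 2 = μ ^ (1 - γ))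
    (z : ℂ) :
    charPoly α (1 - γ) γ μ (s * z) =
      (s ^ 2 * μ : ℝ) * rescaledQuartic s⁻¹ (s ^ 2 / μ) (μ ^ (2 * α) / μ) z := by
  have hγ : μ ^ γ = μ / s ^ 2 := by
    rw [hsμ, Real.rpow_sub hμ, Real.rpow_one]
    field_simp
  have hsum : (1 : ℝ) - γ + γ = 1 := by ring
  have hμ' : (μ : ℂ) ≠ 0 := by exact_mod_cast hμ.ne'
  have hs' : (s : ℂ) ≠ 0 := by exact_mod_cast hs.ne'
  rw [charPoly, rescaledQuartic, hsum, Real.rpow_one, Real.rpow_add hμ, Real.rpow_one, ← hsμ, hγ]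
  push_cast
  field_simp
  ring

/-- The equation `re z = …` for a root of `rescaledQuartic`, in terms of the first factor. -/
theorem rescaledQuartic_root_re_mul_left {ε η κ : ℝ} {z : ℂ}
    (h : rescaledQuartic ε η κ z = 0) (hz : z.im ≠ 0) :
    z.re * (2 * (1 + η) * Complex.normSq (z ^ 2 + ε * z + 1) + 2 * κ) = -(κ * ε) := by
  have hre := congrArg Complex.re h
  have him := congrArg Complex.im h
  simp [rescaledQuartic, pow_two, Complex.normSq_apply] at hre him ⊢
  apply mul_left_cancel₀ hz
  set x := z.re
  set y := z.im
  linear_combination (x * x - y * y + ε * x + 1) * him - (x * y + y * x + ε * y) * hre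

/-- The equation `re z = …` for a root of `rescaledQuartic`, in terms of the second factor. -/
theorem rescaledQuartic_root_re_mul_right {ε η κ : ℝ} {z : ℂ}
    (h : rescaledQuartic ε η κ z = 0) (hz : z.im ≠ 0) :
    z.re * (2 * Complex.normSq ((1 + η) * z ^ 2 + 2 + κ) + 2 * κ * (1 + η)) =
      -(ε * Complex.normSq ((1 + η) * z ^ 2 + 2 + κ)) := by
  have hre := congrArg Complex.re h
  have him := congrArg Complex.im h
  simp [rescaledQuartic, pow_two, Complex.normSq_apply] at hre him ⊢
  apply mul_left_cancel₀ hz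
  set x := z.re
  set y := z.im
  linear_combination ((1 + η) * (x * x - y * y) + 2 + κ) * him
    - ((1 + η) * (x * y + y * x)) * hre

theorem charPoly_roots_F23 (α β γ : ℝ)
    (h1 : 0 ≤ α) (h2 : α < 1 / 2) (h3 : β = 1 - γ)
    (h4 : 0 < γ) (h5 : γ < 1) :
    ∃ M > (0 : ℝ), ∃ l1 l3 : ℝ → ℂ,
      (∀ μ > M,
        charPoly α β γ μ (l1 μ) = 0 ∧ charPoly α β γ μ ((starRingEnd ℂ) (l1 μ)) = 0 ∧
        charPoly α β γ μ (l3 μ) = 0 ∧ charPoly α β γ μ ((starRingEnd ℂ) (l3 μ)) = 0) ∧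
      Tendsto (fun μ : ℝ => (l1 μ).re / (-(1 / 2) * μ ^ (2 * α - 1))) atTop (𝓝 1) ∧
      Tendsto (fun μ : ℝ => (l1 μ).im / (Real.sqrt 2 * μ ^ ((1 - γ) / 2))) atTop (𝓝 1) ∧
      Tendsto (fun μ : ℝ => (l3 μ).re / (-(1 / 2) : ℝ)) atTop (𝓝 1) ∧
      Tendsto (fun μ : ℝ => (l3 μ).im / (μ ^ ((1 - γ) / 2))) atTop (𝓝 1) := by
  subst h3
  set s : ℝ → ℝ := fun μ => μ ^ ((1 - γ) / 2) with hs
  set ε : ℝ → ℝ := fun μ => (s μ)⁻¹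
  set η : ℝ → ℝ := fun μ => s μ ^ 2 / μ with hη
  set κ : ℝ → ℝ := fun μ => μ ^ (2 * α) / μ with hκ
  have hspos : ∀ μ > 0, 0 < s μ := fun μ hμ => Real.rpow_pos_of_pos hμ _
  have hssq : ∀ μ > 0, s μ ^ 2 = μ ^ (1 - γ) := fun μ hμ => by
    rw [hs, ← Real.rpow_natCast, ← Real.rpow_mul hμ.le]
    norm_num
  have hκpow : ∀ μ > 0, κ μ = μ ^ (2 * α - 1) := fun μ hμ => by
    rw [hκ, Real.rpow_sub hμ, Real.rpow_one]
  have hpos : ∀ᶠ μ : ℝ in atTop, 0 < μ := eventually_gt_atTop 0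
  have hε0 : Tendsto ε atTop (𝓝 0) :=
    (tendsto_rpow_atTop (by linarith)).inv_tendsto_atTop
  have hη0 : Tendsto η atTop (𝓝 0) := by
    refine (tendsto_rpow_neg_atTop h4).congr' ?_
    filter_upwards [hpos] with μ hμ
    rw [hη]
    simp only [hssq μ hμ]
    rw [show -γ = 1 - γ - 1 by ring, Real.rpow_sub_one hμ.ne']
  have hκ0 : Tendsto κ atTop (𝓝 0) := by
    refine (tendsto_rpow_neg_atTop (y := 1 - 2 * α) (by linarith)).congr' ?_
    filter_upwards [hpos] with μ hμ
    rw [hκpow μ hμ, neg_sub]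
  have hηnonneg : ∀ μ > 0, 0 ≤ η μ := fun μ hμ => by positivity
  have hη_ev := hpos.mono hηnonneg
  have hsqrt : ((√2 : ℝ) : ℂ) ^ 2 = 2 := by
    rw [← Complex.ofReal_pow, Real.sq_sqrt (by norm_num)]
    norm_num
  have hw1 : ((√2 : ℝ) * Complex.I) ^ 2 = -2 := by
    rw [mul_pow, hsqrt, Complex.I_sq]
    ring
  obtain ⟨z1, hz1, hlim1⟩ := exists_tendsto_rescaledQuartic_root hη_ev hε0 hη0 hκ0
    (w := (√2 : ℝ) * Complex.I) (by rw [hw1]; ring)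
  obtain ⟨z3, hz3, hlim3⟩ := exists_tendsto_rescaledQuartic_root hη_ev hε0 hη0 hκ0
    (w := Complex.I) (by rw [Complex.I_sq]; ring)
  have hroot : ∀ (z : ℝ → ℂ), (∀ μ, 0 ≤ η μ → rescaledQuartic (ε μ) (η μ) (κ μ) (z μ) = 0) →
      ∀ μ > 0, charPoly α (1 - γ) γ μ (s μ * z μ) = 0 := fun z hz μ hμ => by
    rw [charPoly_rescale hμ (hspos μ hμ) (hssq μ hμ), hz μ (hηnonneg μ hμ), mul_zero]
  have him1 : Tendsto (fun μ => (z1 μ).im) atTop (𝓝 √2) := by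
    simpa [Function.comp_def] using (Complex.continuous_im.tendsto _).comp hlim1
  have him3 : Tendsto (fun μ => (z3 μ).im) atTop (𝓝 1) := by
    simpa [Function.comp_def] using (Complex.continuous_im.tendsto _).comp hlim3
  have hεC : Tendsto (fun μ => (ε μ : ℂ)) atTop (𝓝 0) :=
    Complex.ofReal_zero ▸ hε0.ofReal
  have hηC : Tendsto (fun μ => (η μ : ℂ)) atTop (𝓝 0) :=
    Complex.ofReal_zero ▸ hη0.ofReal
  have hκC : Tendsto (fun μ => (κ μ : ℂ)) atTop (𝓝 0) :=
    Complex.ofReal_zero ▸ hκ0.ofReal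
  have hD : Tendsto (fun μ => Complex.normSq (z1 μ ^ 2 + ε μ * z1 μ + 1)) atTop (𝓝 1) := by
    have h := (Complex.continuous_normSq.tendsto _).comp
      (((hlim1.pow 2).add (hεC.mul hlim1)).add_const 1)
    have hval : -2 + 0 * ((√2 : ℝ) * Complex.I) + 1 = -1 := by ring
    rw [hw1, hval, Complex.normSq_neg, map_one] at h
    exact h
  have hG : Tendsto (fun μ => Complex.normSq ((1 + η μ) * z3 μ ^ 2 + 2 + κ μ)) atTop (𝓝 1) := by
    have h := (Complex.continuous_normSq.tendsto _).comp
      ((((hηC.const_add 1).mul (hlim3.pow 2)).add_const 2).add hκC)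
    have hval : (1 + 0) * -1 + 2 + 0 = (1 : ℂ) := by ring
    rw [Complex.I_sq, hval, map_one] at h
    exact h
  refine ⟨1, one_pos, fun μ => s μ * z1 μ, fun μ => s μ * z3 μ, ?_, ?_, ?_, ?_, ?_⟩
  · intro μ hμ
    have hμ0 : 0 < μ := one_pos.trans hμ
    simp only [charPoly_conj, hroot z1 hz1 μ hμ0, hroot z3 hz3 μ hμ0, map_zero, and_self]
  · have hden := ((hη0.const_add 1).mul hD).add hκ0
    rw [add_zero, add_zero, mul_one] at hden
    have h := hden.inv₀ one_ne_zero
    rw [inv_one] at h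
    refine h.congr' ?_
    filter_upwards [hpos, him1.eventually_ne (by positivity),
      hden.eventually_ne one_ne_zero] with μ hμ hy hne
    have hre := rescaledQuartic_root_re_mul_left (hz1 μ (hηnonneg μ hμ)) hy
    have hsε : s μ * ε μ = 1 := mul_inv_cancel₀ (hspos μ hμ).ne'
    have hκne : κ μ ≠ 0 := by rw [hκpow μ hμ]; positivity
    rw [Complex.re_ofReal_mul, ← hκpow μ hμ, inv_eq_one_div, div_eq_div_iff hne (by simpa)]
    linear_combination (-s μ / 2) * hre + κ μ / 2 * hsε
  · have h := him1.div_const √2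
    rw [div_self (by positivity)] at h
    refine h.congr' ?_
    filter_upwards [hpos] with μ hμ
    rw [Complex.im_ofReal_mul, mul_comm √2, mul_div_mul_left _ _ (hspos μ hμ).ne']
  · have hden := hG.add (hκ0.mul (hη0.const_add 1))
    rw [zero_mul, add_zero] at hden
    have h := hG.div hden one_ne_zero
    rw [div_one] at h
    refine h.congr' ?_
    filter_upwards [hpos, him3.eventually_ne one_ne_zero,
      hden.eventually_ne one_ne_zero] with μ hμ hy hne
    have hre := rescaledQuartic_root_re_mul_right (hz3 μ (hηnonneg μ hμ)) hy
    have hsε : s μ * ε μ = 1 := mul_inv_cancel₀ (hspos μ hμ).ne'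
    rw [Complex.re_ofReal_mul, Pi.div_apply, div_eq_div_iff hne (by norm_num)]
    linear_combination (-s μ / 2) * hre
      + Complex.normSq ((1 + η μ) * z3 μ ^ 2 + 2 + κ μ) / 2 * hsε
  · refine him3.congr' ?_
    filter_upwards [hpos] with μ hμ
    rw [Complex.im_ofReal_mul, mul_div_cancel_left₀ _ (hspos μ hμ).ne']
end
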